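/- Let Σ be a type, let u₁, u₂, v₁, v₂ be words over Σ, and let n be a natural number with n > 0. Suppose |del(u₁, v₁)| ≤ n. If del(u₁ ++ u₂, v₁ ++ v₂) ≠ del(u₁, v₁), then |del(u₁ ++ u₂^{3n}, v₁ ++ v₂^{3n})| > n, where u₂^{3n} denotes the 3n-fold concatenation of u₂ with itself. -/

import Mathlib

/-- The canonical map sending a word to the product of the free-group
generators of its letters. -/
def iota {α : Type*} (w : List α) : FreeGroup α :=
  (w.map FreeGroup.of).prod

/-- The delay between two words `u` and `v`. -/
def del {α : Type*} (u v : List α) : FreeGroup α :=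
  (iota u)⁻¹ * iota v

/-- The `i`-fold concatenation of a word with itself. -/
def wpow {α : Type*} (w : List α) (i : ℕ) : List α :=
  (List.replicate i w).flatten

theorem aux_iota_mk {α : Type*} (w : List α) :
    iota w = FreeGroup.mk (w.map fun a => (a, true)) := by
  induction w with
  | nil => rfl
  | cons a w ih =>
    have : iota (a :: w) = FreeGroup.of a * iota w := by simp [iota]
    rw [this, ih]
    rfl

theorem aux_iota_append {α : Type*} (u v : List α) : iota (u ++ v) = iota u * iota v := by
  simp [iota]

theorem aux_norm {α : Type*} [DecidableEq α] (p q : List α)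
    (h : ∀ x ∈ p.head?, ∀ y ∈ q.head?, x ≠ y) :
    FreeGroup.norm (del p q) = p.length + q.length := by
  have hr : FreeGroup.IsReduced
      (FreeGroup.invRev (p.map fun a => (a, true)) ++ q.map fun a => (a, true)) := by
    unfold FreeGroup.IsReduced
    rw [List.isChain_append]
    refine ⟨?_, ?_, ?_⟩
    · apply List.Pairwise.isChain
      apply List.pairwise_of_forall_mem_list
      intro a ha b hb _
      simp [FreeGroup.invRev] at ha hb
      obtain ⟨_, _, rfl⟩ := ha
      obtain ⟨_, _, rfl⟩ := hb
      rfl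
    · apply List.Pairwise.isChain
      apply List.pairwise_of_forall_mem_list
      intro a ha b hb _
      simp at ha hb
      obtain ⟨_, _, rfl⟩ := ha
      obtain ⟨_, _, rfl⟩ := hb
      rfl
    · intro a ha b hb hab
      cases p with
      | nil => simp [FreeGroup.invRev] at ha
      | cons x p =>
        cases q with
        | nil => simp at hb
        | cons y q =>
          simp [FreeGroup.invRev] at ha hb
          subst ha hb
          exact absurd hab (h x (by simp) y (by simp))
  rw [del, aux_iota_mk, aux_iota_mk, FreeGroup.inv_mk, FreeGroup.mul_mk, FreeGroup.norm,
    FreeGroup.toWord_mk, hr.reduce_eq]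
  simp

theorem aux_decomp {α : Type*} [DecidableEq α] (p q : List α) :
    ∃ c p' q', p = c ++ p' ∧ q = c ++ q' ∧
      FreeGroup.norm (del p q) = p'.length + q'.length := by
  induction p generalizing q with
  | nil => exact ⟨[], [], q, rfl, rfl, aux_norm _ _ (by simp)⟩
  | cons a p ih =>
    cases q with
    | nil => exact ⟨[], a :: p, [], rfl, rfl, aux_norm _ _ (by simp)⟩
    | cons b q =>
      by_cases hab : a = b
      · subst hab
        obtain ⟨c, p', q', h1, h2, h3⟩ := ih q
        refine ⟨a :: c, p', q', by simp [h1], by simp [h2], ?_⟩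
        rw [← h3]
        congr 1
        simp [del, iota, mul_assoc]
      · exact ⟨[], a :: p, b :: q, rfl, rfl, aux_norm _ _ (by simpa using hab)⟩

theorem aux_wpow_length {α : Type*} (w : List α) (m : ℕ) :
    (wpow w m).length = m * w.length := by
  simp [wpow]

theorem aux_wpow_succ {α : Type*} (w : List α) (m : ℕ) :
    wpow w (m + 1) = w ++ wpow w m := by
  simp [wpow, List.replicate_succ]

theorem aux_wpow_succ' {α : Type*} (w : List α) (m : ℕ) :
    wpow w (m + 1) = wpow w m ++ w := by
  simp [wpow, List.replicate_succ']

theorem aux_main {α : Type*} [DecidableEq α]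
    (u₁ u₂ v₁ v₂ : List α) (n : ℕ) (hn : 0 < n) (hle : u₁.length ≤ v₁.length)
    (hsmall : FreeGroup.norm (del u₁ v₁) ≤ n)
    (hbig : FreeGroup.norm (del (u₁ ++ wpow u₂ (3 * n)) (v₁ ++ wpow v₂ (3 * n))) ≤ n) :
    del (u₁ ++ u₂) (v₁ ++ v₂) = del u₁ v₁ := by
  obtain ⟨c, p, q, h1, h2, h3⟩ := aux_decomp u₁ v₁
  obtain ⟨C, P, Q, H1, H2, H3⟩ :=
    aux_decomp (u₁ ++ wpow u₂ (3 * n)) (v₁ ++ wpow v₂ (3 * n))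
  have l1 := congrArg List.length h1
  have l2 := congrArg List.length h2
  have L1 := congrArg List.length H1
  have L2 := congrArg List.length H2
  simp only [List.length_append, aux_wpow_length] at l1 l2 L1 L2
  have hl : u₂.length = v₂.length := by
    rcases lt_trichotomy u₂.length v₂.length with h | h | h
    · have := Nat.mul_le_mul_left (3 * n) h
      rw [Nat.mul_succ] at this
      omega
    · exact h
    · have := Nat.mul_le_mul_left (3 * n) h
      rw [Nat.mul_succ] at this
      omega
  rcases Nat.eq_zero_or_pos u₂.length with h0 | hpos
  · have hv : v₂ = [] := List.length_eq_zero_iff.mp (by omega)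
    have hu : u₂ = [] := List.length_eq_zero_iff.mp h0
    simp [hu, hv]
  rw [← hl] at L2
  have hA : n ≤ n * u₂.length := Nat.le_mul_of_pos_right _ hpos
  have hB : u₂.length ≤ n * u₂.length := Nat.le_mul_of_pos_left _ hn
  rw [mul_assoc] at L1 L2
  have hC : v₁.length + u₂.length ≤ C.length := by omega
  obtain ⟨m, hm⟩ : ∃ m, 3 * n = m + 1 := ⟨3 * n - 1, by omega⟩
  have hmlen : m * u₂.length + u₂.length = 3 * (n * u₂.length) := by
    rw [← mul_assoc, hm]; ring
  rw [hm] at H1 H2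
  -- prefixes
  have pC1 : C <+: u₁ ++ wpow u₂ (m + 1) := ⟨P, H1.symm⟩
  have pC2 : C <+: v₁ ++ wpow v₂ (m + 1) := ⟨Q, H2.symm⟩
  have pv : v₁ ++ v₂ <+: v₁ ++ wpow v₂ (m + 1) := by
    rw [aux_wpow_succ, ← List.append_assoc]; exact List.prefix_append _ _
  have pvC : v₁ ++ v₂ <+: C :=
    List.prefix_of_prefix_length_le pv pC2 (by simp only [List.length_append]; omega)
  have pvu : v₁ ++ v₂ <+: u₁ ++ wpow u₂ (m + 1) := pvC.trans pC1
  have puv : u₁ <+: v₁ :=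
    List.prefix_of_prefix_length_le (List.prefix_append _ _)
      ((List.prefix_append _ _).trans pvu) hle
  obtain ⟨r, rfl⟩ := puv
  simp only [List.length_append] at hC l2 L2
  rw [List.append_assoc, List.prefix_append_right_inj] at pvu
  have pr : r <+: wpow u₂ m := by
    have a1 : r <+: wpow u₂ (m + 1) := (List.prefix_append _ _).trans pvu
    have a2 : wpow u₂ m <+: wpow u₂ (m + 1) := by
      rw [aux_wpow_succ']; exact List.prefix_append _ _
    exact List.prefix_of_prefix_length_le a1 a2 (by rw [aux_wpow_length]; omega)
  have pur : u₂ ++ r <+: wpow u₂ (m + 1) := by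
    rw [aux_wpow_succ, List.prefix_append_right_inj]; exact pr
  have heq : r ++ v₂ = u₂ ++ r :=
    (List.prefix_of_prefix_length_le pvu pur (by simp; omega)).eq_of_length (by simp; omega)
  simp only [del, List.append_assoc, heq]
  simp only [aux_iota_append]
  group

theorem aux_del_inv {α : Type*} (u v : List α) : del u v = (del v u)⁻¹ := by
  simp [del]

theorem delay_increases_when_iterating {α : Type*} [DecidableEq α]
    (u₁ u₂ v₁ v₂ : List α) (n : ℕ) (hn : 0 < n)
    (hsmall : FreeGroup.norm (del u₁ v₁) ≤ n)
    (hdiff : del (u₁ ++ u₂) (v₁ ++ v₂) ≠ del u₁ v₁) :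
    n < FreeGroup.norm (del (u₁ ++ wpow u₂ (3 * n)) (v₁ ++ wpow v₂ (3 * n))) := by
  by_contra hcon
  rw [not_lt] at hcon
  apply hdiff
  rcases le_total u₁.length v₁.length with h | h
  · exact aux_main u₁ u₂ v₁ v₂ n hn h hsmall hcon
  · rw [aux_del_inv, FreeGroup.norm_inv_eq] at hsmall hcon
    rw [aux_del_inv, aux_del_inv u₁, aux_main v₁ v₂ u₁ u₂ n hn h hsmall hcon]
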